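/- Let n be a positive integer and let π, ρ ∈ NC^B(n). Suppose that Abs(π) = Abs(ρ) and that π and ρ have a common zero-block Z = -Z ⊆ [±n]. Then π = ρ. -/

import Mathlib

open scoped Classical

namespace NCPB

/-- A collection of subsets of `α` is a partition: blocks are nonempty and
every element lies in exactly one block. -/
def IsPartition {α : Type*} (P : Set (Set α)) : Prop :=
  (∀ B ∈ P, B.Nonempty) ∧ ∀ a : α, ∃! B, B ∈ P ∧ a ∈ B

/-- The non-crossing condition for a collection of subsets of a linear order:
if `a < b < c < d`, `a, c` lie in a block `B` and `b, d` lie in a block `C`,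
then `b ∈ B` (i.e. the blocks coincide). -/
def IsNC {α : Type*} [LinearOrder α] (P : Set (Set α)) : Prop :=
  ∀ B ∈ P, ∀ C ∈ P, ∀ a b c d : α, a < b → b < c → c < d →
    a ∈ B → c ∈ B → b ∈ C → d ∈ C → b ∈ B

/-- A non-crossing partition of a linear order. -/
def NCPart {α : Type*} [LinearOrder α] (P : Set (Set α)) : Prop :=
  IsPartition P ∧ IsNC P

/-- The set `[±m] = {1 < 2 < ... < m < -1 < -2 < ... < -m}` is encoded as `Fin (2*m)`,
position `k < m` encoding `k+1` and position `m + j` encoding `-(j+1)`.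
`negMap` is the inversion map `a ↦ -a`. -/
def negMap (m : ℕ) (k : Fin (2*m)) : Fin (2*m) :=
  ⟨(k.val + m) % (2*m), Nat.mod_lt _ (Nat.lt_of_le_of_lt (Nat.zero_le _) k.isLt)⟩

/-- Image of a subset of `[±m]` under the inversion map, i.e. `X ↦ -X`. -/
def negSet (m : ℕ) (X : Set (Fin (2*m))) : Set (Fin (2*m)) := negMap m '' X

/-- The absolute value map `[±m] → {1,...,m}`, `±i ↦ i`. -/
def absMap (m : ℕ) (k : Fin (2*m)) : Fin m :=
  ⟨k.val % m, Nat.mod_lt _ (by have := k.isLt; omega)⟩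

/-- A non-crossing partition of type B: a non-crossing partition of `[±m]`
invariant under the inversion map. -/
def NCBPart (m : ℕ) (π : Set (Set (Fin (2*m)))) : Prop :=
  NCPart π ∧ ∀ B ∈ π, negSet m B ∈ π

/-- The collection of sets `Abs(X)`, `X` a block of `π`. -/
def absPart (m : ℕ) (π : Set (Set (Fin (2*m)))) : Set (Set (Fin m)) :=
  {F | ∃ X ∈ π, F = absMap m '' X}

/-- The embedding of `{1,...,m}` onto the odd-indexed positions of the interleaved
set `1 < 1̄ < 2 < 2̄ < ... < m < m̄` (encoded as `Fin (2*m)`): `i ↦ i` (even positions). -/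
def evens (m : ℕ) (i : Fin m) : Fin (2*m) := ⟨2*i.val, by have := i.isLt; omega⟩

/-- The embedding of the barred copy `{1̄,...,m̄}` into the interleaved set: odd positions. -/
def odds (m : ℕ) (i : Fin m) : Fin (2*m) := ⟨2*i.val+1, by have := i.isLt; omega⟩

/-- `P` refines... rather: every block of `P` is contained in a block of `Q`
(the partial order on partitions by reverse refinement: `P ≤ Q`). -/
def Refines {α : Type*} (P Q : Set (Set α)) : Prop := ∀ B ∈ P, ∃ C ∈ Q, B ⊆ C

/-- The collection `p ∪ q̄` of subsets of the interleaved set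
`1 < 1̄ < 2 < 2̄ < ... < m < m̄`, with `p` living on the unbarred copy and `q` on the
barred copy. -/
def interleave (m : ℕ) (p q : Set (Set (Fin m))) : Set (Set (Fin (2*m))) :=
  ((fun B => evens m '' B) '' p) ∪ ((fun B => odds m '' B) '' q)

/-- `q` is the Kreweras complement of `p`: `q` is the largest non-crossing partition
(in the reverse-refinement order) such that `p ∪ q̄` is a non-crossing partition of the
interleaved set `1 < 1̄ < ... < m < m̄`. -/
def IsKr (m : ℕ) (p q : Set (Set (Fin m))) : Prop :=
  NCPart q ∧ NCPart (interleave m p q) ∧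
  ∀ q', NCPart q' → NCPart (interleave m p q') → Refines q' q

/-- Two sets cross: there are `a < b < c < d` with `a, c ∈ B` and `b, d ∈ C`. -/
def Crossing {α : Type*} [LinearOrder α] (B C : Set α) : Prop :=
  ∃ a b c d : α, a < b ∧ b < c ∧ c < d ∧ a ∈ B ∧ c ∈ B ∧ b ∈ C ∧ d ∈ C

/-- Two members of a non-crossing family of pairwise disjoint sets: disjoint,
and neither crosses the other. -/
def PairNC {α : Type*} [LinearOrder α] (B C : Set α) : Prop :=
  Disjoint B C ∧ ¬ Crossing B C ∧ ¬ Crossing C B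

end NCPB
namespace NCPB

lemma IsPartition.eq_of_mem {α : Type*} {P : Set (Set α)} (hP : IsPartition P) {B C : Set α}
    (hB : B ∈ P) (hC : C ∈ P) {a : α} (haB : a ∈ B) (haC : a ∈ C) : B = C :=
  (hP.2 a).unique ⟨hB, haB⟩ ⟨hC, haC⟩

lemma absMap_eq_iff {m : ℕ} {x y : Fin (2*m)} : absMap m x = absMap m y ↔ x.val % m = y.val % m := by
  simp [absMap, Fin.ext_iff]

lemma negMap_val_mod {m : ℕ} (x : Fin (2*m)) : (negMap m x).val % m = x.val % m := by
  simp [negMap, Nat.mod_mod_of_dvd _ (Dvd.intro_left 2 rfl : m ∣ 2 * m)]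

lemma mod_eq_ite {m x : ℕ} (hx : x < 2 * m) : x % m = if x < m then x else x - m := by
  split_ifs with h
  · exact Nat.mod_eq_of_lt h
  · rw [Nat.mod_eq_sub_mod (by omega), Nat.mod_eq_of_lt (by omega)]

lemma negMap_val {m : ℕ} (x : Fin (2*m)) :
    (negMap m x).val = if x.val < m then x.val + m else x.val - m := by
  have hx := x.isLt
  simp only [negMap]
  split_ifs with h
  · exact Nat.mod_eq_of_lt (by omega)
  · rw [Nat.mod_eq_sub_mod (by omega), Nat.mod_eq_of_lt (by omega)]
    omega

lemma eq_or_eq_negMap_of_absMap_eq {m : ℕ} {x y : Fin (2*m)} (h : absMap m x = absMap m y) :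
    x = y ∨ x = negMap m y := by
  rw [absMap_eq_iff, mod_eq_ite x.isLt, mod_eq_ite y.isLt] at h
  rw [Fin.ext_iff, Fin.ext_iff, negMap_val]
  have := x.isLt
  have := y.isLt
  split_ifs at h ⊢ <;> omega

lemma absMap_image_negSet {m : ℕ} (X : Set (Fin (2*m))) :
    absMap m '' negSet m X = absMap m '' X := by
  rw [negSet, Set.image_image]
  exact Set.image_congr fun x _ => absMap_eq_iff.2 (negMap_val_mod x)

/-- Blocks of a type B partition whose absolute values meet have equal absolute values. -/
lemma NCBPart.absMap_image_eq {m : ℕ} {π : Set (Set (Fin (2*m)))} (hπ : NCBPart m π)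
    {X Y : Set (Fin (2*m))} (hX : X ∈ π) (hY : Y ∈ π) {x y : Fin (2*m)} (hx : x ∈ X) (hy : y ∈ Y)
    (h : absMap m x = absMap m y) : absMap m '' X = absMap m '' Y := by
  rcases eq_or_eq_negMap_of_absMap_eq h with rfl | rfl
  · rw [hπ.1.1.eq_of_mem hX hY hx hy]
  · rw [hπ.1.1.eq_of_mem hX (hπ.2 Y hY) hx ⟨y, hy, rfl⟩, absMap_image_negSet]

lemma exists_antipodal_mem {m : ℕ} {Z : Set (Fin (2*m))} (hne : Z.Nonempty)
    (hinv : negSet m Z = Z) : ∃ z ∈ Z, ∃ w ∈ Z, w.val = z.val + m := by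
  obtain ⟨z, hz⟩ := hne
  have hz' : negMap m z ∈ Z := hinv ▸ Set.mem_image_of_mem _ hz
  have hv := negMap_val z
  by_cases h : z.val < m
  · exact ⟨z, hz, _, hz', by rw [hv, if_pos h]⟩
  · exact ⟨_, hz', z, hz, by rw [hv, if_neg h]; omega⟩

/-- A block other than `Z` cannot meet both arcs cut out by two points of the block `Z`. -/
lemma NCPart.mem_Ioo_of_mem {α : Type*} [LinearOrder α] {P : Set (Set α)} (hP : NCPart P)
    {X Z : Set α} (hX : X ∈ P) (hZ : Z ∈ P) (hne : X ≠ Z) {z w x y : α} (hz : z ∈ Z) (hw : w ∈ Z)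
    (hx : x ∈ X) (hy : y ∈ X) (hxI : x ∈ Set.Ioo z w) : y ∈ Set.Ioo z w := by
  have hdisj : ∀ a ∈ X, a ∉ Z := fun a ha haZ => hne (hP.1.eq_of_mem hX hZ ha haZ)
  refine ⟨lt_of_not_ge fun h => ?_, lt_of_not_ge fun h => ?_⟩
  · have hlt : y < z := lt_of_le_of_ne h fun e => hdisj y hy (e ▸ hz)
    exact hdisj z (hP.2 X hX Z hZ y z x w hlt hxI.1 hxI.2 hy hx hz hw) hz
  · have hlt : w < y := lt_of_le_of_ne h fun e => hdisj y hy (e ▸ hw)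
    exact hdisj x hx (hP.2 Z hZ X hX z x w y hxI.1 hxI.2 hlt hz hw hx hy)

lemma eq_of_absMap_eq_of_mem_Ioo_iff {m : ℕ} {z w x y : Fin (2*m)} (hzw : w.val = z.val + m)
    (hx : x ≠ z ∧ x ≠ w) (h : absMap m x = absMap m y)
    (hI : x ∈ Set.Ioo z w ↔ y ∈ Set.Ioo z w) : x = y := by
  rw [absMap_eq_iff, mod_eq_ite x.isLt, mod_eq_ite y.isLt] at h
  simp only [Set.mem_Ioo, Fin.lt_def, ne_eq, Fin.ext_iff] at *
  have := x.isLt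
  have := y.isLt
  have := w.isLt
  split_ifs at h <;> omega

lemma subset_of_common_zero_block {m : ℕ} {π ρ : Set (Set (Fin (2*m)))} (hπ : NCBPart m π)
    (hρ : NCBPart m ρ) (habs : absPart m π = absPart m ρ) {Z : Set (Fin (2*m))} (hZπ : Z ∈ π)
    (hZρ : Z ∈ ρ) (hZinv : negSet m Z = Z) : π ⊆ ρ := by
  intro X hX
  by_cases hXZ : X = Z
  · exact hXZ ▸ hZρ
  obtain ⟨z, hz, w, hw, hzw⟩ := exists_antipodal_mem (hπ.1.1.1 Z hZπ) hZinv
  obtain ⟨x, hx⟩ := hπ.1.1.1 X hX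
  obtain ⟨Y, ⟨hY, hxY⟩, -⟩ := hρ.1.1.2 x
  have hYZ : Y ≠ Z := by
    rintro rfl
    exact hXZ (hπ.1.1.eq_of_mem hX hZπ hx hxY)
  have habsXY : absMap m '' X = absMap m '' Y := by
    obtain ⟨X', hX', he⟩ : absMap m '' X ∈ absPart m ρ := habs ▸ ⟨X, hX, rfl⟩
    obtain ⟨x', hx', hxx'⟩ : absMap m x ∈ absMap m '' X' := he ▸ ⟨x, hx, rfl⟩
    rw [he, hρ.absMap_image_eq hX' hY hx' hxY hxx']
  have hIoo : ∀ a ∈ X, ∀ b ∈ Y, (a ∈ Set.Ioo z w ↔ b ∈ Set.Ioo z w) := fun a ha b hb =>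
    ⟨fun h => hρ.1.mem_Ioo_of_mem hY hZρ hYZ hz hw hxY hb
        (hπ.1.mem_Ioo_of_mem hX hZπ hXZ hz hw ha hx h),
      fun h => hπ.1.mem_Ioo_of_mem hX hZπ hXZ hz hw hx ha
        (hρ.1.mem_Ioo_of_mem hY hZρ hYZ hz hw hb hxY h)⟩
  have heq : ∀ a ∈ X, ∀ b ∈ Y, absMap m a = absMap m b → a = b := fun a ha b hb h =>
    eq_of_absMap_eq_of_mem_Ioo_iff hzw
      ⟨fun e => hXZ (hπ.1.1.eq_of_mem hX hZπ ha (e ▸ hz)),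
        fun e => hXZ (hπ.1.1.eq_of_mem hX hZπ ha (e ▸ hw))⟩ h (hIoo a ha b hb)
  have hXY : X = Y := by
    ext a
    constructor
    · intro ha
      obtain ⟨b, hb, hab⟩ : absMap m a ∈ absMap m '' Y := habsXY ▸ ⟨a, ha, rfl⟩
      exact heq a ha b hb hab.symm ▸ hb
    · intro ha
      obtain ⟨b, hb, hab⟩ : absMap m a ∈ absMap m '' X := habsXY ▸ ⟨a, ha, rfl⟩
      exact heq b hb a ha hab ▸ hb
  exact hXY ▸ hY

end NCPB

open NCPB in
/-- If `π, ρ ∈ NC^B(n)` have the same absolute value and a common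
zero-block `Z = -Z`, then `π = ρ`. -/
theorem eq_of_abs_eq_of_common_zero_block (n : ℕ) (hn : 0 < n)
    (π ρ : Set (Set (Fin (2*n)))) (hπ : NCBPart n π) (hρ : NCBPart n ρ)
    (habs : absPart n π = absPart n ρ)
    (Z : Set (Fin (2*n))) (hZπ : Z ∈ π) (hZρ : Z ∈ ρ) (hZinv : negSet n Z = Z) :
    π = ρ := by
  exact (subset_of_common_zero_block hπ hρ habs hZπ hZρ hZinv).antisymm
    (subset_of_common_zero_block hρ hπ habs.symm hZρ hZπ hZinv)
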